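/- For x, u, w ∈ ℝⁿ define Δ_x(u, w) = limsup_{t→0⁺} sup{ d(y + t·u, y + t·w)/t : y ∈ B̄(x, t) }. Then there exists a Borel set 𝒰 ⊆ ℝⁿ whose complement has Lebesgue measure zero such that for every x ∈ 𝒰: (a) for every v ∈ ℝⁿ, lim_{t→0⁺} sup{ |d(y, y + t·v)/t − Δ_x(0, v)| : y ∈ B̄(x, t) } = 0; (b) for every v ∈ ℝⁿ and every s ≥ 0, Δ_x(0, s·v) = s · Δ_x(0, v); (c) for every v ∈ ℝⁿ, Δ_x(0, v) = Δ_x(v, 0) = Δ_x(0, −v); (d) for all u, w ∈ ℝⁿ, Δ_x(u, w) = Δ_x(0, w − u). -/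

import Mathlib

open Filter Metric Set MeasureTheory

/-- Lower derivate of a distance function `d` on `ℝⁿ` at `x` in direction `v`:
`liminf_{t→0⁺} inf { d(y, y + t•v)/t : y ∈ B̄(x,t) }`. -/
noncomputable def lowerDerivate {n : ℕ}
    (d : EuclideanSpace ℝ (Fin n) → EuclideanSpace ℝ (Fin n) → ℝ)
    (x v : EuclideanSpace ℝ (Fin n)) : ℝ :=
  Filter.liminf
    (fun t : ℝ => sInf ((fun y => d y (y + t • v) / t) '' Metric.closedBall x t))
    (nhdsWithin 0 (Set.Ioi 0))

/-- Upper derivate of a distance function `d` on `ℝⁿ` at `x` in direction `v`: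
`limsup_{t→0⁺} sup { d(y, y + t•v)/t : y ∈ B̄(x,t) }`. -/
noncomputable def upperDerivate {n : ℕ}
    (d : EuclideanSpace ℝ (Fin n) → EuclideanSpace ℝ (Fin n) → ℝ)
    (x v : EuclideanSpace ℝ (Fin n)) : ℝ :=
  Filter.limsup
    (fun t : ℝ => sSup ((fun y => d y (y + t • v) / t) '' Metric.closedBall x t))
    (nhdsWithin 0 (Set.Ioi 0))

/-- `Δ_x(u, w) = limsup_{t→0⁺} sup { d(y + t•u, y + t•w)/t : y ∈ B̄(x,t) }`. -/
noncomputable def Delta {n : ℕ}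
    (d : EuclideanSpace ℝ (Fin n) → EuclideanSpace ℝ (Fin n) → ℝ)
    (x u w : EuclideanSpace ℝ (Fin n)) : ℝ :=
  Filter.limsup
    (fun t : ℝ =>
      sSup ((fun y => d (y + t • u) (y + t • w) / t) '' Metric.closedBall x t))
    (nhdsWithin 0 (Set.Ioi 0))

open scoped NNReal Topology

/-- Up to an arbitrarily small error, uniform in `z`, the distance `d y z` is at most the
increment from `y` to `z` of one of the functions `d (p i)`. -/
theorem exists_dist_le_increment_add {E : Type*} [NormedAddCommGroup E]
    {d : E → E → ℝ} {p : ℕ → E} {K : ℝ≥0} (hp : DenseRange p) (hsymm : ∀ a b, d a b = d b a)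
    (htri : ∀ a b c, d a c ≤ d a b + d b c) (hle : ∀ a b, d a b ≤ K * ‖a - b‖)
    (y : E) {r : ℝ} (hr : 0 < r) :
    ∃ i, ∀ z, d y z ≤ d (p i) z - d (p i) y + 2 * K * r := by
  obtain ⟨i, hi⟩ := hp.exists_dist_lt y hr
  refine ⟨i, fun z => ?_⟩
  have h1 : d y (p i) ≤ K * r :=
    (hle _ _).trans (mul_le_mul_of_nonneg_left (by rw [← dist_eq_norm]; exact hi.le) K.2)
  linarith [htri y (p i) z, hsymm y (p i)]

theorem setIntegral_closedBall_comp_add_right {E : Type*} [NormedAddCommGroup E]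
    [MeasurableSpace E] [BorelSpace E] {μ : Measure E} [μ.IsAddRightInvariant]
    (g : E → ℝ) (y a : E) (r : ℝ) :
    ∫ z in closedBall y r, g (z + a) ∂μ = ∫ z in closedBall (y + a) r, g z ∂μ := by
  rw [← (measurePreserving_add_right μ a).setIntegral_preimage_emb
    (measurableEmbedding_addRight a) g]
  congr 2
  ext z
  simp

section MetricDifferential

variable {E : Type*} [NormedAddCommGroup E] [NormedSpace ℝ E]

/-- The supremum of the moduli of the directional derivatives at `x`, in direction `v`, of the
functions `d (p i)`. For a dense sequence `p` it is the metric differential of `d` at almost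
every `x`. -/
noncomputable def metricDifferential (d : E → E → ℝ) (p : ℕ → E) (x v : E) : ℝ :=
  ⨆ i, |fderiv ℝ (d (p i)) x v|

theorem LipschitzWith.abs_fderiv_apply_le {f : E → ℝ} {K : ℝ≥0} (hf : LipschitzWith K f)
    (x v : E) : |fderiv ℝ f x v| ≤ K * ‖v‖ :=
  (fderiv ℝ f x).le_of_opNorm_le (norm_fderiv_le_of_lipschitz ℝ hf) v

namespace metricDifferential

variable {d : E → E → ℝ} {p : ℕ → E} {K : ℝ≥0}

theorem abs_fderiv_le (hd : ∀ a, LipschitzWith K (d a)) (x v : E) (i : ℕ) :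
    |fderiv ℝ (d (p i)) x v| ≤ metricDifferential d p x v :=
  le_ciSup (f := fun i => |fderiv ℝ (d (p i)) x v|)
    ⟨K * ‖v‖, by rintro _ ⟨j, rfl⟩; exact (hd _).abs_fderiv_apply_le x v⟩ i

theorem nonneg (x v : E) : 0 ≤ metricDifferential d p x v :=
  Real.iSup_nonneg fun _ => abs_nonneg _

theorem le_mul_norm (hd : ∀ a, LipschitzWith K (d a)) (x v : E) :
    metricDifferential d p x v ≤ K * ‖v‖ :=
  ciSup_le fun _ => (hd _).abs_fderiv_apply_le x v

theorem add_le (hd : ∀ a, LipschitzWith K (d a)) (x v w : E) :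
    metricDifferential d p x (v + w) ≤ metricDifferential d p x v + metricDifferential d p x w := by
  refine ciSup_le fun i => ?_
  rw [map_add]
  exact (abs_add_le _ _).trans (add_le_add (abs_fderiv_le hd x v i) (abs_fderiv_le hd x w i))

theorem smul_of_nonneg (x v : E) {s : ℝ} (hs : 0 ≤ s) :
    metricDifferential d p x (s • v) = s * metricDifferential d p x v := by
  simp only [metricDifferential, map_smul, smul_eq_mul, abs_mul, abs_of_nonneg hs]
  exact (Real.mul_iSup_of_nonneg hs _).symm

theorem neg (x v : E) : metricDifferential d p x (-v) = metricDifferential d p x v := by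
  simp only [metricDifferential, map_neg, abs_neg]

theorem measurable [MeasurableSpace E] [BorelSpace E] (d : E → E → ℝ) (p : ℕ → E)
    (v : E) :
    Measurable fun x => metricDifferential d p x v :=
  Measurable.iSup fun i => (measurable_fderiv_apply_const ℝ (d (p i)) v).abs

end metricDifferential

/-- A function differentiable at `x` has, at scale `t`, increments close to linear uniformly over
base points at distance `O(t)` from `x`. -/
theorem DifferentiableAt.eventually_abs_increment_sub_le {f : E → ℝ} {x : E}
    (hf : DifferentiableAt ℝ f x) (v : E) {R ε : ℝ} (hR : 0 ≤ R) (hε : 0 < ε) :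
    ∀ᶠ t : ℝ in 𝓝[>] 0, ∀ y ∈ closedBall x (R * t),
      |f (y + t • v) - f y - t * fderiv ℝ f x v| ≤ ε * t := by
  have hC : 0 < R + ‖v‖ + 1 := by positivity
  have hc : 0 < ε / (2 * (R + ‖v‖ + 1)) := by positivity
  obtain ⟨δ, hδ, hball⟩ :=
    Metric.eventually_nhds_iff.1 ((hasFDerivAt_iff_isLittleO.1 hf.hasFDerivAt).def hc)
  have hsmall : ∀ᶠ t : ℝ in 𝓝[>] 0, t < δ / (R + ‖v‖ + 1) :=
    mem_nhdsWithin_of_mem_nhds (Iio_mem_nhds (by positivity))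
  filter_upwards [hsmall, self_mem_nhdsWithin] with t ht ht0 y hy
  have ht0 : 0 < t := ht0
  rw [lt_div_iff₀ hC] at ht
  have key : ∀ z, ‖z - x‖ ≤ t * (R + ‖v‖ + 1) →
      |f z - f x - fderiv ℝ f x (z - x)| ≤ ε / 2 * t := by
    intro z hz
    have h := hball (y := z) (by rw [dist_eq_norm]; linarith)
    rw [Real.norm_eq_abs] at h
    refine h.trans ((mul_le_mul_of_nonneg_left hz hc.le).trans (le_of_eq ?_))
    field_simp
  have hyx : ‖y - x‖ ≤ R * t := by rwa [mem_closedBall, dist_eq_norm] at hy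
  have h1 := key y (by nlinarith [mul_nonneg ht0.le (norm_nonneg v)])
  have h2 := key (y + t • v) (by
    have h : ‖y + t • v - x‖ ≤ ‖y - x‖ + ‖t • v‖ := by
      rw [add_sub_right_comm]; exact norm_add_le _ _
    rw [norm_smul, Real.norm_of_nonneg ht0.le] at h
    linarith)
  have hlin : fderiv ℝ f x (y + t • v - x) = fderiv ℝ f x (y - x) + t * fderiv ℝ f x v := by
    rw [add_sub_right_comm, map_add, map_smul, smul_eq_mul]
  rw [hlin] at h2
  rw [abs_le] at h1 h2 ⊢
  constructor <;> linarith [h1.1, h1.2, h2.1, h2.2]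

variable [MeasurableSpace E] [BorelSpace E] [FiniteDimensional ℝ E] {μ : Measure E}
  [μ.IsAddHaarMeasure]

theorem LipschitzWith.hasDerivAt_setIntegral_closedBall_add_smul {f : E → ℝ} {K : ℝ≥0}
    (hf : LipschitzWith K f) (y v : E) (r s : ℝ) :
    HasDerivAt (fun s : ℝ => ∫ z in closedBall y r, f (z + s • v) ∂μ)
      (∫ z in closedBall (y + s • v) r, fderiv ℝ f z v ∂μ) s := by
  rw [← setIntegral_closedBall_comp_add_right (fun z => fderiv ℝ f z v)]
  have hcont : ∀ s : ℝ, Continuous fun z => f (z + s • v) := fun s =>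
    hf.continuous.comp (continuous_add_const _)
  refine (hasDerivAt_integral_of_dominated_loc_of_lip (s := univ)
    (bound := fun _ => (K : ℝ) * ‖v‖) univ_mem
    (.of_forall fun s => (hcont s).aestronglyMeasurable)
    ((hcont s).continuousOn.integrableOn_compact (isCompact_closedBall _ _))
    ?_ (.of_forall fun z => ?_) (integrableOn_const measure_closedBall_lt_top.ne) ?_).2
  · exact ((measurable_fderiv_apply_const ℝ f v).comp
      (measurable_add_const _)).aestronglyMeasurable
  · refine LipschitzOnWith.of_dist_le_mul fun a _ b _ => (hf.dist_le_mul _ _).trans (le_of_eq ?_)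
    rw [dist_add_left, dist_eq_norm, ← sub_smul, norm_smul, ← dist_eq_norm, Real.coe_nnabs,
      abs_of_nonneg (by positivity)]
    ring
  · have hae : ∀ᵐ z ∂μ, DifferentiableAt ℝ f (z + s • v) :=
      (measurePreserving_add_right μ (s • v)).quasiMeasurePreserving.ae hf.ae_differentiableAt
    filter_upwards [ae_restrict_of_ae hae] with z hz
    have hline : HasDerivAt (fun s : ℝ => z + s • v) v s := by
      simpa using ((hasDerivAt_id s).smul_const v).const_add z
    exact hz.hasFDerivAt.comp_hasDerivAt s hline

/-- The mean value inequality for a Lipschitz function, in terms of averages of its derivative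
over small balls centred on a segment. -/
theorem LipschitzWith.increment_le_of_average_fderiv_le {f : E → ℝ} {K : ℝ≥0}
    (hf : LipschitzWith K f) {y v : E} {r t M : ℝ} (hr : 0 < r) (ht : 0 ≤ t)
    (hM : ∀ s ∈ Icc 0 t, ⨍ z in closedBall (y + s • v) r, fderiv ℝ f z v ∂μ ≤ M) :
    f (y + t • v) - f y ≤ t * M + 2 * K * r := by
  set m := μ.real (closedBall y r) with hm
  have hm0 : 0 < m := ENNReal.toReal_pos (measure_closedBall_pos μ y hr).ne'
    measure_closedBall_lt_top.ne
  have hvol : ∀ s : ℝ, μ.real (closedBall (y + s • v) r) = m := fun s => by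
    simp only [hm, measureReal_def, Measure.addHaar_closedBall_center μ _ r]
  have hderiv := hf.hasDerivAt_setIntegral_closedBall_add_smul (μ := μ) y v r
  have hmean := (convex_Icc 0 t).image_sub_le_mul_sub_of_deriv_le
    (fun s _ => (hderiv s).continuousAt.continuousWithinAt)
    (fun s _ => (hderiv s).differentiableAt.differentiableWithinAt) (C := m * M)
    (fun s hs => by
      have h := hM s (interior_subset hs)
      rw [setAverage_eq, hvol, smul_eq_mul, inv_mul_le_iff₀ hm0] at h
      rwa [(hderiv s).deriv]) 0 ⟨le_rfl, ht⟩ t ⟨ht, le_rfl⟩ ht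
  have hint : ∀ s : ℝ, IntegrableOn (fun z => f (z + s • v)) (closedBall y r) μ := fun s =>
    (hf.continuous.comp (continuous_add_const _)).continuousOn.integrableOn_compact
      (isCompact_closedBall _ _)
  have hpt : ∀ a, ∀ z ∈ closedBall y r, |f (z + a) - f (y + a)| ≤ K * r := fun a z hz =>
    (hf.dist_le_mul _ _).trans (mul_le_mul_of_nonneg_left (by simpa using hz) K.2)
  have hconst : ∀ c : ℝ, ∫ _ in closedBall y r, c ∂μ = m * c := fun c => by
    rw [setIntegral_const, smul_eq_mul]
  have hIc : ∀ c : ℝ, IntegrableOn (fun _ => c) (closedBall y r) μ := fun c =>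
    integrableOn_const measure_closedBall_lt_top.ne
  have hupper : m * (f (y + t • v) - K * r) ≤ ∫ z in closedBall y r, f (z + t • v) ∂μ := by
    rw [← hconst]
    exact setIntegral_mono_on (hIc _) (hint t) measurableSet_closedBall fun z hz => by
      linarith [(abs_le.1 (hpt (t • v) z hz)).1]
  have hlower : ∫ z in closedBall y r, f (z + (0 : ℝ) • v) ∂μ ≤ m * (f y + K * r) := by
    rw [← hconst]
    refine setIntegral_mono_on (hint 0) (hIc _) measurableSet_closedBall fun z hz => ?_
    have h := (abs_le.1 (hpt 0 z hz)).2
    simp only [zero_smul, add_zero] at h ⊢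
    linarith
  refine le_of_mul_le_mul_left ?_ hm0
  linarith

/-- Lebesgue differentiation, uniformly over balls of radius `t` whose centre is at distance
`O(t)` from the point. -/
theorem ae_eventually_average_abs_sub_le {g : E → ℝ} (hg : LocallyIntegrable g μ) :
    ∀ᵐ x ∂μ, ∀ (R : ℝ) {ε : ℝ}, 0 < ε → ∀ᶠ r : ℝ in 𝓝[>] 0, ∀ w, x ∈ closedBall w (R * r) →
      ⨍ z in closedBall w r, |g z - g x| ∂μ ≤ ε := by
  filter_upwards [ae_all_iff.2 fun k : ℕ =>
    IsUnifLocDoublingMeasure.ae_tendsto_average_norm_sub μ hg k] with x hx R ε hε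
  obtain ⟨k, hk⟩ := exists_nat_ge R
  have h := hx k (ι := E × ℝ)
    (l := comap Prod.snd (𝓝[>] 0) ⊓ 𝓟 {q : E × ℝ | x ∈ closedBall q.1 (k * q.2)})
    Prod.fst Prod.snd (tendsto_comap.mono_left inf_le_left) (mem_inf_of_right (mem_principal_self _))
  have h' := h.eventually (Iic_mem_nhds hε)
  rw [eventually_inf_principal, eventually_comap] at h'
  filter_upwards [h', self_mem_nhdsWithin] with r hr hr0 w hw
  exact hr (w, r) rfl (closedBall_subset_closedBall
    (mul_le_mul_of_nonneg_right hk (le_of_lt hr0)) hw)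

namespace metricDifferential

variable {d : E → E → ℝ} {p : ℕ → E} {K : ℝ≥0}

theorem locallyIntegrable (hd : ∀ a, LipschitzWith K (d a)) (v : E) :
    LocallyIntegrable (fun x => metricDifferential d p x v) μ := by
  refine (locallyIntegrable_const ((K : ℝ) * ‖v‖)).mono
    (measurable d p v).aestronglyMeasurable (.of_forall fun x => ?_)
  rw [Real.norm_of_nonneg (nonneg x v), Real.norm_of_nonneg (by positivity)]
  exact le_mul_norm hd x v

theorem average_fderiv_le (hd : ∀ a, LipschitzWith K (d a)) (x v w : E) {r : ℝ} (hr : 0 < r)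
    (i : ℕ) :
    ⨍ z in closedBall w r, fderiv ℝ (d (p i)) z v ∂μ ≤ metricDifferential d p x v +
      ⨍ z in closedBall w r, |metricDifferential d p z v - metricDifferential d p x v| ∂μ := by
  set m := μ.real (closedBall w r) with hm
  have hm0 : 0 < m := ENNReal.toReal_pos (measure_closedBall_pos μ w hr).ne'
    measure_closedBall_lt_top.ne
  have hIc : ∀ c : ℝ, IntegrableOn (fun _ => c) (closedBall w r) μ := fun c =>
    integrableOn_const measure_closedBall_lt_top.ne
  have hIN : IntegrableOn (fun z => metricDifferential d p z v) (closedBall w r) μ :=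
    (locallyIntegrable hd v).integrableOn_isCompact (isCompact_closedBall _ _)
  have hIabs : IntegrableOn
      (fun z => |metricDifferential d p z v - metricDifferential d p x v|) (closedBall w r) μ :=
    (hIN.sub (hIc _)).abs
  have hIf : IntegrableOn (fun z => fderiv ℝ (d (p i)) z v) (closedBall w r) μ :=
    hIN.mono' (measurable_fderiv_apply_const ℝ _ v).aestronglyMeasurable
      (.of_forall fun z => abs_fderiv_le hd z v i)
  have hle : ∫ z in closedBall w r, fderiv ℝ (d (p i)) z v ∂μ ≤
      ∫ z in closedBall w r, (metricDifferential d p x v +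
        |metricDifferential d p z v - metricDifferential d p x v|) ∂μ :=
    integral_mono hIf ((hIc _).add hIabs) fun z => by
      have h1 := abs_fderiv_le (p := p) hd z v i
      simp only
      linarith [le_abs_self (fderiv ℝ (d (p i)) z v),
        le_abs_self (metricDifferential d p z v - metricDifferential d p x v)]
  rw [integral_add (hIc _) hIabs, setIntegral_const, smul_eq_mul] at hle
  rw [setAverage_eq, setAverage_eq, smul_eq_mul, smul_eq_mul, inv_mul_le_iff₀ hm0, mul_add,
    mul_inv_cancel_left₀ hm0.ne']
  exact hle

theorem ae_eventually_dist_le (hp : DenseRange p) (hd : ∀ a, LipschitzWith K (d a))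
    (hsymm : ∀ a b, d a b = d b a) (htri : ∀ a b c, d a c ≤ d a b + d b c)
    (hle : ∀ a b, d a b ≤ K * ‖a - b‖) (v : E) :
    ∀ᵐ x ∂μ, ∀ (R : ℝ) {ε : ℝ}, 0 < ε → ∀ᶠ t : ℝ in 𝓝[>] 0, ∀ y ∈ closedBall x (R * t),
      d y (y + t • v) ≤ t * (metricDifferential d p x v + ε) := by
  filter_upwards [ae_eventually_average_abs_sub_le (locallyIntegrable (μ := μ) (p := p) hd v)]
    with x hx R ε hε
  have hK : (0 : ℝ) < K + 1 := by positivity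
  set κ : ℝ := ε / (8 * (K + 1)) with hκ
  have hκ0 : 0 < κ := by positivity
  have hκε : K * κ ≤ ε / 8 := by
    rw [hκ, ← mul_div_assoc, div_le_div_iff₀ (by positivity) (by norm_num)]
    nlinarith
  have hscale : Tendsto (fun t : ℝ => κ * t) (𝓝[>] 0) (𝓝[>] 0) := by
    refine tendsto_nhdsWithin_iff.2 ⟨?_, ?_⟩
    · simpa using ((continuous_const_mul κ).tendsto 0).mono_left nhdsWithin_le_nhds
    · filter_upwards [self_mem_nhdsWithin] with t ht using mul_pos hκ0 ht
  filter_upwards [hscale.eventually (hx ((R + ‖v‖) / κ) (half_pos hε)), self_mem_nhdsWithin]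
    with t ht ht0 y hy
  have ht0 : 0 < t := ht0
  obtain ⟨i, hi⟩ := exists_dist_le_increment_add hp hsymm htri hle y (mul_pos hκ0 ht0)
  have hinc := (hd (p i)).increment_le_of_average_fderiv_le (μ := μ) (y := y) (v := v)
    (M := metricDifferential d p x v + ε / 2) (mul_pos hκ0 ht0) ht0.le fun s hs => by
      refine (average_fderiv_le hd x v _ (mul_pos hκ0 ht0) i).trans
        (add_le_add le_rfl (ht _ ?_))
      have heq : (R + ‖v‖) / κ * (κ * t) = R * t + t * ‖v‖ := by field_simp
      rw [heq, mem_closedBall']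
      refine (dist_triangle _ y _).trans (add_le_add ?_ hy)
        |>.trans_eq (add_comm _ _)
      rw [dist_self_add_left, norm_smul, Real.norm_of_nonneg hs.1]
      exact mul_le_mul_of_nonneg_right hs.2 (norm_nonneg v)
  have := hi (y + t • v)
  nlinarith [mul_le_mul_of_nonneg_right hκε ht0.le]

/-- A Lipschitz pseudometric is metrically differentiable almost everywhere, in the strong sense
that base points may vary at distance `O(t)` from the point. -/
theorem ae_eventually_abs_dist_sub_le (hp : DenseRange p) (hd : ∀ a, LipschitzWith K (d a))
    (hsymm : ∀ a b, d a b = d b a) (htri : ∀ a b c, d a c ≤ d a b + d b c)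
    (hle : ∀ a b, d a b ≤ K * ‖a - b‖) :
    ∀ᵐ x ∂μ, ∀ (v : E) {R ε : ℝ}, 0 ≤ R → 0 < ε →
      ∀ᶠ t : ℝ in 𝓝[>] 0, ∀ y ∈ closedBall x (R * t),
        |d y (y + t • v) - t * metricDifferential d p x v| ≤ ε * t := by
  filter_upwards [ae_all_iff.2 fun i => (hd (p i)).ae_differentiableAt (μ := μ),
    ae_all_iff.2 fun j => ae_eventually_dist_le (μ := μ) hp hd hsymm htri hle (p j)]
    with x hdiff hup v R ε hR hε
  have hK : (0 : ℝ) < K + 1 := by positivity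
  obtain ⟨j, hj⟩ := hp.exists_dist_lt v (ε := ε / (3 * (K + 1))) (by positivity)
  have hKj : K * ‖v - p j‖ ≤ ε / 3 := by
    rw [← dist_eq_norm]
    rw [lt_div_iff₀ (by positivity)] at hj
    nlinarith [dist_nonneg (x := v) (y := p j)]
  obtain ⟨i, hi⟩ := exists_lt_of_lt_ciSup
    (show metricDifferential d p x v - ε / 2 < ⨆ i, |fderiv ℝ (d (p i)) x v| from
      sub_lt_self _ (half_pos hε))
  filter_upwards [hup j R (show 0 < ε / 3 by positivity), self_mem_nhdsWithin,
    (hdiff i).eventually_abs_increment_sub_le v hR (half_pos hε)] with t hupt ht0 hlow y hy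
  have ht0 : 0 < t := ht0
  have hupper : d y (y + t • v) ≤ t * metricDifferential d p x v + ε * t := by
    have h1 := htri y (y + t • p j) (y + t • v)
    have h2 : d (y + t • p j) (y + t • v) ≤ t * (ε / 3) := by
      refine (hle _ _).trans ?_
      rw [add_sub_add_left_eq_sub, ← smul_sub, norm_smul, Real.norm_of_nonneg ht0.le,
        norm_sub_rev, mul_left_comm]
      exact mul_le_mul_of_nonneg_left hKj ht0.le
    have h3 : metricDifferential d p x (p j) ≤ metricDifferential d p x v + ε / 3 := by
      have h := add_le (p := p) hd x v (p j - v)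
      rw [add_sub_cancel] at h
      have h' := le_mul_norm (p := p) hd x (p j - v)
      rw [norm_sub_rev] at h'
      linarith
    have h4 := hupt y hy
    nlinarith [mul_le_mul_of_nonneg_left h3 ht0.le]
  have hlower : t * metricDifferential d p x v - ε * t ≤ d y (y + t • v) := by
    have h1 : |d (p i) (y + t • v) - d (p i) y| ≤ d y (y + t • v) := by
      rw [abs_le]
      constructor <;>
        linarith [htri (p i) y (y + t • v), htri (p i) (y + t • v) y, hsymm y (y + t • v)]
    have h2 := hlow y hy
    have h3 : |t * fderiv ℝ (d (p i)) x v| = t * |fderiv ℝ (d (p i)) x v| := by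
      rw [abs_mul, abs_of_pos ht0]
    have h4 := abs_sub_abs_le_abs_sub (t * fderiv ℝ (d (p i)) x v)
      (d (p i) (y + t • v) - d (p i) y)
    rw [abs_sub_comm (t * _)] at h4
    nlinarith [mul_lt_mul_of_pos_left hi ht0]
  rw [abs_le]
  constructor <;> linarith

end metricDifferential

end MetricDifferential

/-- Suprema over shrinking balls of functions converging uniformly to a constant converge to this
constant. -/
theorem tendsto_sSup_image_closedBall {E : Type*} [PseudoMetricSpace E] {g : ℝ → E → ℝ} {x : E}
    {c : ℝ} (h : ∀ ε > 0, ∀ᶠ t : ℝ in 𝓝[>] 0, ∀ y ∈ closedBall x t, |g t y - c| ≤ ε) :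
    Tendsto (fun t : ℝ => sSup (g t '' closedBall x t)) (𝓝[>] 0) (𝓝 c) := by
  refine Metric.tendsto_nhds.2 fun ε hε => ?_
  filter_upwards [h (ε / 2) (half_pos hε), self_mem_nhdsWithin] with t ht ht0
  have hx : x ∈ closedBall x t := mem_closedBall_self (le_of_lt ht0)
  have hub : ∀ b ∈ g t '' closedBall x t, b ≤ c + ε / 2 := by
    rintro _ ⟨y, hy, rfl⟩
    linarith [(abs_le.1 (ht y hy)).2]
  have h1 := csSup_le (Set.Nonempty.image _ ⟨x, hx⟩) hub
  have h2 := le_csSup ⟨_, hub⟩ (mem_image_of_mem (g t) hx)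
  rw [Real.dist_eq, abs_lt]
  constructor <;> linarith [(abs_le.1 (ht x hx)).1]

/-- Where `d` is strongly metrically differentiable, `Delta` is the metric differential. -/
theorem Delta_eq_of_eventually_abs_dist_sub_le {n : ℕ}
    {d : EuclideanSpace ℝ (Fin n) → EuclideanSpace ℝ (Fin n) → ℝ}
    {x : EuclideanSpace ℝ (Fin n)} {N : EuclideanSpace ℝ (Fin n) → ℝ}
    (h : ∀ (v : EuclideanSpace ℝ (Fin n)) {R ε : ℝ}, 0 ≤ R → 0 < ε →
      ∀ᶠ t : ℝ in 𝓝[>] 0, ∀ y ∈ closedBall x (R * t), |d y (y + t • v) - t * N v| ≤ ε * t)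
    (u w : EuclideanSpace ℝ (Fin n)) : Delta d x u w = N (w - u) := by
  refine (tendsto_sSup_image_closedBall fun ε hε => ?_).limsup_eq
  filter_upwards [h (w - u) (R := 1 + ‖u‖) (by positivity) hε, self_mem_nhdsWithin]
    with t ht ht0 y hy
  have ht0 : 0 < t := ht0
  have hmem : y + t • u ∈ closedBall x ((1 + ‖u‖) * t) := by
    rw [mem_closedBall]
    refine (dist_triangle _ y _).trans ?_
    rw [dist_self_add_left, norm_smul, Real.norm_of_nonneg ht0.le]
    linarith [mem_closedBall.1 hy]
  have hy' := ht _ hmem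
  rw [add_assoc, ← smul_add, add_sub_cancel] at hy'
  rwa [div_sub' ht0.ne', abs_div, abs_of_pos ht0, div_le_iff₀ ht0]

/-- For a pseudometric `d` on `ℝⁿ` that is `L`-Lipschitz with
respect to the Euclidean distance, there is a Borel set `𝒰` of full Lebesgue
measure such that for every `x ∈ 𝒰` the function `Δ_x` is (a) the uniform limit
of the difference quotients, (b) positively homogeneous, (c) symmetric, and
(d) translation invariant: `Δ_x(u, w) = Δ_x(0, w − u)`. -/
theorem Delta_differentiability
    {n : ℕ} (L : ℝ) (hL : 0 < L)
    (d : EuclideanSpace ℝ (Fin n) → EuclideanSpace ℝ (Fin n) → ℝ)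
    (hsymm : ∀ a b, d a b = d b a)
    (hdiag : ∀ a, d a a = 0)
    (htri : ∀ a b c, d a c ≤ d a b + d b c)
    (hLip : ∀ a b, d a b ≤ L * ‖a - b‖) :
    ∃ 𝒰 : Set (EuclideanSpace ℝ (Fin n)), MeasurableSet 𝒰 ∧ volume 𝒰ᶜ = 0 ∧
      ∀ x ∈ 𝒰,
        (∀ v : EuclideanSpace ℝ (Fin n),
          Filter.Tendsto
            (fun t : ℝ =>
              sSup ((fun y => |d y (y + t • v) / t - Delta d x 0 v|) ''
                Metric.closedBall x t))
            (nhdsWithin 0 (Set.Ioi 0)) (nhds 0)) ∧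
        (∀ (v : EuclideanSpace ℝ (Fin n)) (s : ℝ), 0 ≤ s →
          Delta d x 0 (s • v) = s * Delta d x 0 v) ∧
        (∀ v : EuclideanSpace ℝ (Fin n),
          Delta d x 0 v = Delta d x v 0 ∧ Delta d x 0 v = Delta d x 0 (-v)) ∧
        (∀ u w : EuclideanSpace ℝ (Fin n), Delta d x u w = Delta d x 0 (w - u)) := by
  lift L to ℝ≥0 using hL.le
  have hd : ∀ a, LipschitzWith L (d a) := fun a => LipschitzWith.of_le_add_mul L fun b c => by
    rw [dist_eq_norm, norm_sub_rev]
    linarith [htri a c b, hLip c b]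
  set p := TopologicalSpace.denseSeq (EuclideanSpace ℝ (Fin n))
  have hae := metricDifferential.ae_eventually_abs_dist_sub_le (μ := volume)
    (TopologicalSpace.denseRange_denseSeq _ : DenseRange p) hd hsymm htri hLip
  obtain ⟨s, hs, hs_meas, hs_null⟩ := exists_measurable_superset_of_null (ae_iff.1 hae)
  refine ⟨sᶜ, hs_meas.compl, by rwa [compl_compl], fun x hx => ?_⟩
  have hxd := not_not.1 fun h => hx (hs h)
  have hΔ := Delta_eq_of_eventually_abs_dist_sub_le hxd
  refine ⟨fun v => ?_, fun v s hs => ?_, fun v => ⟨?_, ?_⟩, fun u w => ?_⟩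
  · refine tendsto_sSup_image_closedBall fun ε hε => ?_
    filter_upwards [hxd v zero_le_one hε, self_mem_nhdsWithin] with t ht ht0 y hy
    have ht0 : 0 < t := ht0
    rw [sub_zero, abs_abs, hΔ, sub_zero, div_sub' ht0.ne', abs_div, abs_of_pos ht0,
      div_le_iff₀ ht0]
    exact ht y (by rwa [one_mul])
  · rw [hΔ, hΔ, sub_zero, sub_zero, metricDifferential.smul_of_nonneg x v hs]
  · rw [hΔ, hΔ, sub_zero, zero_sub, metricDifferential.neg]
  · rw [hΔ, hΔ, sub_zero, sub_zero, metricDifferential.neg]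
  · rw [hΔ, hΔ, sub_zero]
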